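/- arXiv:1307.4420 — 3 statements merged into one kernel-verified Lean document; each statement's English description precedes it below -/
import Mathlib

section
/- Let G be a finite simple undirected graph and let F be a simple 2-matching of G. Then there exists an orientation D of G and a control matching M of D with |M| = |F|. -/
/-- In a directed graph with arc set `A`, a control matching is a set `M ⊆ A` of arcs such
that each vertex is the head of at most one arc in `M` and the tail of at most one arc in `M`. -/
def IsControlMatching {V : Type*} (A M : Finset (V × V)) : Prop :=
  M ⊆ A ∧ (∀ a ∈ M, ∀ b ∈ M, a.1 = b.1 → a = b) ∧ (∀ a ∈ M, ∀ b ∈ M, a.2 = b.2 → a = b)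

/-- `A` is an orientation of the undirected graph `G`: every arc of `A` corresponds to an
edge of `G`, and each edge of `G` receives exactly one of its two possible directions. -/
def IsOrientation {V : Type*} (G : SimpleGraph V) (A : Finset (V × V)) : Prop :=
  (∀ p ∈ A, G.Adj p.1 p.2) ∧ (∀ u v : V, G.Adj u v → (((u, v) ∈ A) ↔ ((v, u) ∉ A)))

/-- A simple 2-matching of `G`: a set of edges of `G` such that every vertex is incident
to at most two edges of it. -/
def IsSimple2Matching {V : Type*} [DecidableEq V] (G : SimpleGraph V)
    (F : Finset (Sym2 V)) : Prop :=
  (↑F ⊆ G.edgeSet) ∧ ∀ v : V, (F.filter (fun e => v ∈ e)).card ≤ 2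

/-- `R` directs every edge of `F` in exactly one way, so that every vertex has at most one
out-neighbour and at most one in-neighbour. -/
structure IsPathOrientation {V : Type*} (F : Finset (Sym2 V)) (R : V → V → Prop) : Prop where
  mem : ∀ a b, R a b → s(a, b) ∈ F
  iff_not : ∀ a b, s(a, b) ∈ F → (R a b ↔ ¬ R b a)
  out_unique : ∀ a b c, R a b → R a c → b = c
  in_unique : ∀ a b c, R b a → R c a → b = c

namespace IsPathOrientation

variable {V : Type*} {F : Finset (Sym2 V)} {R : V → V → Prop}

theorem swap (h : IsPathOrientation F R) : IsPathOrientation F (fun a b => R b a) where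
  mem a b hab := Sym2.eq_swap ▸ h.mem b a hab
  iff_not a b hab := h.iff_not b a (Sym2.eq_swap ▸ hab)
  out_unique := h.in_unique
  in_unique := h.out_unique

open Classical in
/-- Reversing all arcs inside a union of components. -/
theorem flip_on (h : IsPathOrientation F R) {S : Set V} (hS : ∀ a b, R a b → (a ∈ S ↔ b ∈ S)) :
    IsPathOrientation F (fun a b => if a ∈ S then R b a else R a b) where
  mem a b hab := by
    have := h.mem a b
    have := h.mem b a
    rw [Sym2.eq_swap] at this
    grind
  iff_not a b hab := by
    have := h.iff_not a b hab
    grind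
  out_unique a b c := by
    have := h.out_unique a b c
    have := h.in_unique a b c
    grind
  in_unique a b c := by
    have := h.out_unique a b c
    have := h.in_unique a b c
    grind

theorem not_in_of_out (h : IsPathOrientation F R) {u a b : V}
    (hu : ∀ e ∈ F, ∀ e' ∈ F, u ∈ e → u ∈ e' → e = e') (ha : R u a) : ¬ R b u := by
  intro hb
  have heq := hu _ (h.mem _ _ ha) _ (h.mem _ _ hb) (by simp) (by simp)
  have hab : a = b := by
    rw [Sym2.eq_swap] at heq
    exact Sym2.congr_left.mp heq
  subst hab
  exact (h.iff_not _ _ (h.mem _ _ ha)).mp ha hb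

/-- If `u ≠ v` have degree at most one, an orientation can be chosen in which `u` has no
out-arc and `v` has no in-arc. -/
theorem exists_free (h : IsPathOrientation F R) {u v : V} (huv : u ≠ v)
    (hu : ∀ e ∈ F, ∀ e' ∈ F, u ∈ e → u ∈ e' → e = e')
    (hv : ∀ e ∈ F, ∀ e' ∈ F, v ∈ e → v ∈ e' → e = e') :
    ∃ R', IsPathOrientation F R' ∧ (∀ a, ¬ R' u a) ∧ ∀ a, ¬ R' a v := by
  classical
  wlog hout : ∀ a, ¬ R u a generalizing R
  · push Not at hout
    obtain ⟨a, ha⟩ := hout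
    exact this h.swap fun b => h.not_in_of_out hu ha
  by_cases hin : ∀ a, ¬ R a v
  · exact ⟨R, h, hout, hin⟩
  push Not at hin
  obtain ⟨w, hw⟩ := hin
  have hv' : ∀ a, ¬ R v a := fun a ha => h.not_in_of_out hv ha hw
  let S : Set V := {x | Relation.ReflTransGen R x v}
  have hS : ∀ a b, R a b → (a ∈ S ↔ b ∈ S) := fun a b hab => by
    refine ⟨fun ha => ?_, fun hb => Relation.ReflTransGen.head hab hb⟩
    rcases Relation.ReflTransGen.cases_head ha with rfl | ⟨c, hc, hcv⟩
    · exact absurd hab (hv' b)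
    · exact h.out_unique a c b hc hab ▸ hcv
  have huS : u ∉ S := fun hmem => by
    rcases Relation.ReflTransGen.cases_head hmem with rfl | ⟨c, hc, -⟩
    · exact huv rfl
    · exact hout c hc
  have hvS : v ∈ S := Relation.ReflTransGen.refl
  refine ⟨_, h.flip_on hS, fun a => by simpa [huS] using hout a, fun a => ?_⟩
  have := hS a v
  have := hv' a
  grind

theorem insert_edge [DecidableEq V] (h : IsPathOrientation F R) {u v : V} (huv : u ≠ v)
    (hF : s(u, v) ∉ F) (hu : ∀ a, ¬ R u a) (hv : ∀ a, ¬ R a v) :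
    IsPathOrientation (insert s(u, v) F) (fun a b => R a b ∨ (a = u ∧ b = v)) where
  mem a b hab := by
    have := h.mem a b
    grind
  iff_not a b hab := by
    have h₁ := h.mem u v
    have h₂ := h.mem v u
    rw [Sym2.eq_swap] at h₂
    rw [Finset.mem_insert, Sym2.eq_iff] at hab
    have h₃ := h.iff_not a b
    have h₄ : s(a, b) = s(b, a) := Sym2.eq_swap
    grind
  out_unique a b c := by
    have := h.out_unique a b c
    grind
  in_unique a b c := by
    have := h.in_unique a b c
    grind

end IsPathOrientation

theorem exists_isPathOrientation {V : Type*} [DecidableEq V] (F : Finset (Sym2 V))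
    (hloop : ∀ e ∈ F, ¬ e.IsDiag) (hdeg : ∀ v : V, (F.filter (fun e => v ∈ e)).card ≤ 2) :
    ∃ R, IsPathOrientation F R := by
  induction F using Finset.induction_on with
  | empty => exact ⟨fun _ _ => False, by constructor <;> simp⟩
  | insert e F he ih =>
    obtain ⟨R, hR⟩ := ih (fun e' he' => hloop e' (Finset.mem_insert_of_mem he')) fun v =>
      (Finset.card_le_card (Finset.filter_subset_filter _ (Finset.subset_insert e F))).trans
        (hdeg v)
    have hone : ∀ v ∈ e, ∀ e₁ ∈ F, ∀ e₂ ∈ F, v ∈ e₁ → v ∈ e₂ → e₁ = e₂ := by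
      intro v hve e₁ h₁ e₂ h₂ hv₁ hv₂
      have hv := hdeg v
      rw [Finset.filter_insert, if_pos hve, Finset.card_insert_of_notMem (by simp [he])] at hv
      exact Finset.card_le_one.mp (Nat.le_of_succ_le_succ hv) e₁ (by simp [h₁, hv₁]) e₂
        (by simp [h₂, hv₂])
    induction e using Sym2.ind with
    | _ u v =>
      have huv : u ≠ v := by simpa using hloop s(u, v) (Finset.mem_insert_self _ _)
      obtain ⟨R', hR', hu, hv⟩ := hR.exists_free huv (hone u (by simp)) (hone v (by simp))
      exact ⟨_, hR'.insert_edge huv he hu hv⟩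

theorem stmt2 {V : Type*} [Fintype V] [DecidableEq V] (G : SimpleGraph V)
    (F : Finset (Sym2 V)) (hF : IsSimple2Matching G F) :
    ∃ A M : Finset (V × V), IsOrientation G A ∧ IsControlMatching A M ∧
      M.card = F.card := by
  classical
  obtain ⟨hsub, hdeg⟩ := hF
  have hadj : ∀ a b, s(a, b) ∈ F → G.Adj a b := fun a b hab => hsub hab
  obtain ⟨R, hR⟩ := exists_isPathOrientation F
    (fun e he => G.not_isDiag_of_mem_edgeSet (hsub he)) hdeg
  let φ := Fintype.equivFin V
  refine ⟨Finset.univ.filter fun p : V × V =>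
      G.Adj p.1 p.2 ∧ if s(p.1, p.2) ∈ F then R p.1 p.2 else φ p.1 < φ p.2,
    Finset.univ.filter fun p : V × V => R p.1 p.2, ⟨?_, ?_⟩, ⟨?_, ?_, ?_⟩, ?_⟩
  · simp +contextual
  · intro u v huv
    have hne : φ u ≠ φ v := φ.injective.ne huv.ne
    have := hR.iff_not u v
    have hswap : s(v, u) = s(u, v) := Sym2.eq_swap
    simp only [Finset.mem_filter, Finset.mem_univ, true_and, huv, huv.symm, hswap]
    split_ifs with h
    · exact this h
    · omega
  · intro p hp
    have hp : R p.1 p.2 := by simpa using hp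
    simp [hp, hR.mem _ _ hp, hadj _ _ (hR.mem _ _ hp)]
  · rintro ⟨a, b⟩ hp ⟨c, d⟩ hq (rfl : a = c)
    rw [hR.out_unique a b d (by simpa using hp) (by simpa using hq)]
  · rintro ⟨a, b⟩ hp ⟨c, d⟩ hq (rfl : b = d)
    rw [hR.in_unique b a c (by simpa using hp) (by simpa using hq)]
  · refine Finset.card_bij (fun p _ => s(p.1, p.2)) (fun p hp => ?_) ?_ fun e he => ?_
    · exact hR.mem _ _ (by simpa using hp)
    · rintro ⟨a, b⟩ hp ⟨c, d⟩ hq heq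
      have hp : R a b := by simpa using hp
      have hq : R c d := by simpa using hq
      rcases Sym2.eq_iff.mp heq with ⟨rfl, rfl⟩ | ⟨rfl, rfl⟩
      · rfl
      · exact absurd hq ((hR.iff_not _ _ (hR.mem _ _ hp)).mp hp)
    · induction e using Sym2.ind with
      | _ a b =>
        by_cases hab : R a b
        · exact ⟨(a, b), by simpa using hab, rfl⟩
        · refine ⟨(b, a), ?_, Sym2.eq_swap⟩
          have := hR.iff_not a b he
          simp only [Finset.mem_filter, Finset.mem_univ, true_and]
          tauto
end

section
/- For every finite simple undirected graph G, the maximum, over all orientations D of G, of the maximum cardinality of a control matching of D is equal to the maximum cardinality of a simple 2-matching of G. -/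
/-- Two fixed-point-free involutions have a common alternating two-colouring. -/
theorem exists_alternating_coloring {D : Type*} (a b : Equiv.Perm D)
    (ha : ∀ x, a (a x) = x) (hb : ∀ x, b (b x) = x) (ha' : ∀ x, a x ≠ x)
    (hb' : ∀ x, b x ≠ x) :
    ∃ c : D → Prop, (∀ x, c (a x) ↔ ¬ c x) ∧ (∀ x, c (b x) ↔ ¬ c x) := by
  set r : Equiv.Perm D := a * b with hr
  have haa : a * a = 1 := Equiv.ext ha
  have hbb : b * b = 1 := Equiv.ext hb
  have hsemi : SemiconjBy a r r⁻¹ := by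
    have h1 : r⁻¹ = b * a := by
      rw [inv_eq_iff_mul_eq_one, hr, mul_assoc, ← mul_assoc b, hbb, one_mul, haa]
    rw [SemiconjBy, h1, hr, ← mul_assoc, haa, mul_assoc, haa, one_mul, mul_one]
  have hpow (k : ℤ) (x : D) : a ((r ^ k) x) = (r ^ (-k)) (a x) := by
    have h := (hsemi.zpow_right k).eq
    rw [inv_zpow'] at h
    exact DFunLike.congr_fun h x
  have hmap {x y : D} (h : r.SameCycle x y) : r.SameCycle (a x) (a y) := by
    obtain ⟨k, rfl⟩ := h
    exact ⟨-k, (hpow k x).symm⟩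
  have hmap' {x y : D} (h : r.SameCycle (a x) y) : r.SameCycle x (a y) := by
    simpa [ha] using hmap h
  have hnot (x : D) : ¬ r.SameCycle x (a x) := by
    rintro ⟨k, hk⟩
    obtain ⟨m, rfl | rfl⟩ := k.even_or_odd'
    · apply ha' ((r ^ m) x)
      rw [hpow, ← hk, ← Equiv.Perm.mul_apply, ← zpow_add]
      congr 2
      ring
    · apply hb' ((r ^ m) x)
      apply a.injective
      change r ((r ^ m) x) = _
      rw [hpow, ← hk, ← Equiv.Perm.mul_apply, ← Equiv.Perm.mul_apply, ← zpow_one_add,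
        ← zpow_add]
      congr 2
      ring
  have hab (x : D) : r.SameCycle (a x) (b x) := by
    refine Equiv.Perm.SameCycle.symm ⟨1, ?_⟩
    rw [zpow_one, hr, Equiv.Perm.mul_apply, hb]
  let S : Setoid D :=
    { r := fun x y => r.SameCycle x y ∨ r.SameCycle (a x) y
      iseqv :=
        { refl := fun x => Or.inl (Equiv.Perm.SameCycle.refl r x)
          symm := by
            rintro x y (h | h)
            · exact Or.inl h.symm
            · exact Or.inr (hmap' h).symm
          trans := by
            rintro x y z (h | h) (h' | h')
            · exact Or.inl (h.trans h')
            · exact Or.inr ((hmap h).trans h')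
            · exact Or.inr (h.trans h')
            · exact Or.inl ((hmap' h).trans h') } }
  let rep : D → D := fun x => (Quotient.mk S x).out
  have hrep (x : D) : r.SameCycle (rep x) x ∨ r.SameCycle (a (rep x)) x :=
    Quotient.mk_out (s := S) x
  have hrep_eq {x y : D} (h : r.SameCycle (a x) y) : rep y = rep x := by
    have : Quotient.mk S x = Quotient.mk S y := Quotient.sound (Or.inr h)
    simp only [rep, this]
  have hflip {x y : D} (h : r.SameCycle (a x) y) :
      r.SameCycle (rep y) y ↔ ¬ r.SameCycle (rep x) x := by
    rw [hrep_eq h]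
    constructor
    · intro h1 h2
      exact hnot x (h2.symm.trans (h1.trans h.symm))
    · intro h1
      have h2 := (hrep x).resolve_left h1
      exact (hmap' h2).trans h
  exact ⟨fun x => r.SameCycle (rep x) x, fun x => hflip (Equiv.Perm.SameCycle.refl r _),
    fun x => hflip (hab x)⟩

/-- If `a` is a fixed-point-free involution and all fibres of `f` have at most two elements,
then some two-colouring separates `x` from `a x` and is injective on each fibre of `f`. -/
theorem exists_coloring_of_fibers_le_two {D V : Type*} (a : D → D) (f : D → V)
    (ha : ∀ x, a (a x) = x) (ha' : ∀ x, a x ≠ x)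
    (hf : ∀ x y z, f x = f y → f x = f z → x = y ∨ x = z ∨ y = z) :
    ∃ c : D → Prop, (∀ x, c (a x) ↔ ¬ c x) ∧
      (∀ x y, f x = f y → x ≠ y → (c y ↔ ¬ c x)) := by
  classical
  have hex (x : D) : ∃ y, f x = f y ∧ ∀ z, f x = f z → x ≠ z → y = z := by
    by_cases h : ∃ y, f x = f y ∧ x ≠ y
    · obtain ⟨y, hy, hxy⟩ := h
      exact ⟨y, hy, fun z hz hxz => ((hf x y z hy hz).resolve_left hxy).resolve_left hxz⟩
    · exact ⟨x, rfl, fun z hz hxz => (h ⟨z, hz, hxz⟩).elim⟩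
  choose b hbf hbu using hex
  have hb (x : D) : b (b x) = x := by
    by_cases h : b x = x
    · rw [h, h]
    · exact hbu _ _ (hbf x).symm h
  let a₂ : D × Bool → D × Bool := fun p => (a p.1, p.2)
  let b₂ : D × Bool → D × Bool := fun p => (b p.1, if b p.1 = p.1 then !p.2 else p.2)
  have ha₂ : Function.Involutive a₂ := fun p => Prod.ext (ha p.1) rfl
  have hb₂ : Function.Involutive b₂ := by
    rintro ⟨x, i⟩
    by_cases h : b x = x
    · simp [b₂, h]
    · simp [b₂, hb, h, Ne.symm h]
  obtain ⟨c, hca, hcb⟩ := exists_alternating_coloring ha₂.toPerm hb₂.toPerm ha₂ hb₂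
    (fun p h => ha' p.1 (congrArg Prod.fst h)) (by
      rintro ⟨x, i⟩ h
      have h1 : b x = x := congrArg Prod.fst h
      have h2 := congrArg Prod.snd h
      simp [b₂, h1] at h2)
  refine ⟨fun x => c (x, true), fun x => hca (x, true), fun x y hxy hne => ?_⟩
  have hy := hbu x y hxy hne
  have h := hcb (x, true)
  simpa [b₂, hy, hne.symm] using h

theorem IsControlMatching.exists_isSimple2Matching {V : Type*} [DecidableEq V]
    {G : SimpleGraph V} {A M : Finset (V × V)} (hA : IsOrientation G A)
    (hM : IsControlMatching A M) :
    ∃ F : Finset (Sym2 V), IsSimple2Matching G F ∧ F.card = M.card := by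
  obtain ⟨hMA, htail, hhead⟩ := hM
  refine ⟨M.image (fun p => s(p.1, p.2)), ⟨?_, ?_⟩, ?_⟩
  · intro e he
    obtain ⟨p, hp, rfl⟩ := Finset.mem_image.mp (Finset.mem_coe.mp he)
    exact hA.1 p (hMA hp)
  · intro v
    have hsub : (M.image (fun p => s(p.1, p.2))).filter (fun e => v ∈ e) ⊆
        (M.filter (fun p => p.1 = v) ∪ M.filter (fun p => p.2 = v)).image
          (fun p => s(p.1, p.2)) := by
      intro e he
      obtain ⟨he, hv⟩ := Finset.mem_filter.mp he
      obtain ⟨p, hp, rfl⟩ := Finset.mem_image.mp he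
      refine Finset.mem_image_of_mem _ ?_
      rw [Finset.mem_union, Finset.mem_filter, Finset.mem_filter]
      rcases Sym2.mem_iff.mp hv with h | h
      · exact Or.inl ⟨hp, h.symm⟩
      · exact Or.inr ⟨hp, h.symm⟩
    have h1 : (M.filter (fun p => p.1 = v)).card ≤ 1 := by
      refine Finset.card_le_one.mpr fun p hp q hq => ?_
      rw [Finset.mem_filter] at hp hq
      exact htail p hp.1 q hq.1 (hp.2.trans hq.2.symm)
    have h2 : (M.filter (fun p => p.2 = v)).card ≤ 1 := by
      refine Finset.card_le_one.mpr fun p hp q hq => ?_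
      rw [Finset.mem_filter] at hp hq
      exact hhead p hp.1 q hq.1 (hp.2.trans hq.2.symm)
    calc _ ≤ _ := Finset.card_le_card hsub
      _ ≤ _ := Finset.card_image_le
      _ ≤ _ := Finset.card_union_le _ _
      _ ≤ 2 := by omega
  · refine Finset.card_image_of_injOn ?_
    rintro ⟨u, v⟩ hp ⟨x, y⟩ hq h
    rcases Sym2.eq_iff.mp h with ⟨rfl, rfl⟩ | ⟨rfl, rfl⟩
    · rfl
    · exact ((hA.2 _ _ (hA.1 _ (hMA hp))).mp (hMA hp) (hMA hq)).elim

theorem IsSimple2Matching.exists_isControlMatching {V : Type*} [Fintype V] [DecidableEq V]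
    {G : SimpleGraph V} {F : Finset (Sym2 V)} (hF : IsSimple2Matching G F) :
    ∃ A M : Finset (V × V), IsOrientation G A ∧ IsControlMatching A M ∧ M.card = F.card := by
  classical
  obtain ⟨hFG, hdeg⟩ := hF
  have hadj {u v : V} (h : s(u, v) ∈ F) : G.Adj u v := hFG (Finset.mem_coe.mpr h)
  let D := {p : V × V // s(p.1, p.2) ∈ F}
  let a : D → D := fun p =>
    ⟨p.1.swap, by rw [Prod.fst_swap, Prod.snd_swap, Sym2.eq_swap]; exact p.2⟩
  obtain ⟨c, hca, hcf⟩ := exists_coloring_of_fibers_le_two a (fun p : D => p.1.1)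
    (fun _ => rfl) (fun p h => (hadj p.2).ne (congrArg (fun q : D => q.1.2) h)) (by
      rintro ⟨⟨u, x⟩, hx⟩ ⟨⟨v, y⟩, hy⟩ ⟨⟨w, z⟩, hz⟩ h1 h2
      dsimp only at h1 h2
      subst h1 h2
      by_contra! h
      have h3 : ({s(u, x), s(u, y), s(u, z)} : Finset (Sym2 V)).card = 3 := by
        refine Finset.card_eq_three.mpr ⟨_, _, _, fun he => h.1 ?_, fun he => h.2.1 ?_,
          fun he => h.2.2 ?_, rfl⟩ <;>
          exact Subtype.ext (Prod.ext rfl (Sym2.congr_right.mp he))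
      have h4 : ({s(u, x), s(u, y), s(u, z)} : Finset (Sym2 V)) ⊆
          F.filter (fun e => u ∈ e) := by
        intro e he
        simp only [Finset.mem_insert, Finset.mem_singleton] at he
        rcases he with rfl | rfl | rfl <;> simpa
      have := Finset.card_le_card h4
      have := hdeg u
      omega)
  let M : Finset (V × V) := Finset.univ.filter (fun p => ∃ h : s(p.1, p.2) ∈ F, c ⟨p, h⟩)
  have hM (p : V × V) : p ∈ M ↔ ∃ h : s(p.1, p.2) ∈ F, c ⟨p, h⟩ := by simp [M]
  have hswap {u v : V} (h : s(u, v) ∈ F) : (v, u) ∈ M ↔ (u, v) ∉ M := by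
    have h' : s(v, u) ∈ F := by rwa [Sym2.eq_swap]
    have := hca ⟨(u, v), h⟩
    simpa [hM, h, h', a] using this
  have htail : ∀ p ∈ M, ∀ q ∈ M, p.1 = q.1 → p = q := by
    intro p hp q hq h
    obtain ⟨hpF, hpc⟩ := (hM p).mp hp
    obtain ⟨hqF, hqc⟩ := (hM q).mp hq
    by_contra hne
    exact (hcf ⟨p, hpF⟩ ⟨q, hqF⟩ h (fun he => hne (congrArg Subtype.val he))).mp hqc hpc
  have hhead : ∀ p ∈ M, ∀ q ∈ M, p.2 = q.2 → p = q := by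
    intro p hp q hq h
    obtain ⟨hpF, hpc⟩ := (hM p).mp hp
    obtain ⟨hqF, hqc⟩ := (hM q).mp hq
    by_contra hne
    have hne' : a ⟨p, hpF⟩ ≠ a ⟨q, hqF⟩ := fun he =>
      hne (Prod.swap_injective (congrArg Subtype.val he))
    exact (hca ⟨q, hqF⟩).mp ((hcf (a ⟨p, hpF⟩) (a ⟨q, hqF⟩) h hne').mpr
      fun h' => (hca ⟨p, hpF⟩).mp h' hpc) hqc
  let e := Fintype.equivFin V
  let A : Finset (V × V) := Finset.univ.filter
    (fun p => G.Adj p.1 p.2 ∧ (p ∈ M ∨ s(p.1, p.2) ∉ F ∧ e p.1 < e p.2))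
  refine ⟨A, M, ⟨?_, ?_⟩, ⟨?_, htail, hhead⟩, ?_⟩
  · intro p hp
    exact (Finset.mem_filter.mp hp).2.1
  · intro u v huv
    simp only [A, Finset.mem_filter, Finset.mem_univ, true_and, huv, huv.symm]
    by_cases h : s(u, v) ∈ F
    · have h' : s(v, u) ∈ F := by rwa [Sym2.eq_swap]
      simp [h, h', hswap h]
    · have h' : s(v, u) ∉ F := by rwa [Sym2.eq_swap]
      have hlt : e u < e v ↔ ¬ e v < e u := by
        have : e u ≠ e v := e.injective.ne huv.ne
        rw [not_lt]
        exact ⟨le_of_lt, fun hle => lt_of_le_of_ne hle this⟩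
      simpa [hM, h, h'] using hlt
  · intro p hp
    simp only [A, Finset.mem_filter, Finset.mem_univ, true_and]
    exact ⟨hadj ((hM p).mp hp).1, Or.inl hp⟩
  · have himage : M.image (fun p => s(p.1, p.2)) = F := by
      ext x
      induction x with | _ u v
      rw [Finset.mem_image]
      constructor
      · rintro ⟨p, hp, h⟩
        exact h ▸ ((hM p).mp hp).1
      · intro h
        by_cases hm : (u, v) ∈ M
        · exact ⟨_, hm, rfl⟩
        · exact ⟨_, (hswap h).mpr hm, Sym2.eq_swap⟩
    rw [← himage]
    refine (Finset.card_image_of_injOn ?_).symm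
    rintro ⟨u, v⟩ hp ⟨x, y⟩ hq h
    rcases Sym2.eq_iff.mp h with ⟨rfl, rfl⟩ | ⟨rfl, rfl⟩
    · rfl
    · exact ((hswap ((hM _).mp hp).1).mp hq hp).elim

/-- The maximum over all orientations of `G` of the maximum cardinality of a control
matching equals the maximum cardinality of a simple 2-matching of `G`. -/
theorem stmt3 {V : Type*} [Fintype V] [DecidableEq V] (G : SimpleGraph V) :
    sSup {n : ℕ | ∃ A M : Finset (V × V),
        IsOrientation G A ∧ IsControlMatching A M ∧ M.card = n} =
      sSup {n : ℕ | ∃ F : Finset (Sym2 V), IsSimple2Matching G F ∧ F.card = n} := by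
  congr 1
  ext n
  constructor
  · rintro ⟨A, M, hA, hM, rfl⟩
    exact hM.exists_isSimple2Matching hA
  · rintro ⟨F, hF, rfl⟩
    exact hF.exists_isControlMatching
end

section
/- Let G = (V, A) be a finite simple directed graph, let G' = (V, A') be its symmetric closure (A' contains (u,v) and (v,u) whenever (u,v) ∈ A), and define weights w(u,v) = 1 if (u,v) ∈ A and w(u,v) = 0 otherwise. Then G has a 3-cycle cover (a set of vertex-disjoint simple directed cycles, each with at least 3 vertices, covering all vertices of G) if and only if some orientation-set of G' contains a control matching of weight |V|. -/
/-- An orientation-set of the symmetric digraph with arc set `A`: a subset of `A`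
containing exactly one of `(x, y)` and `(y, x)` for each symmetric pair of arcs. -/
def IsOrientationSet {V : Type*} (A σ : Finset (V × V)) : Prop :=
  σ ⊆ A ∧ ∀ p ∈ A, (p ∈ σ ↔ Prod.swap p ∉ σ)

/-- `C ⊆ A` is a 3-cycle cover: a set of vertex-disjoint simple directed cycles, each with
at least 3 vertices, covering all vertices.  Equivalently, `C` is the graph of a
permutation of `V` (every vertex has in- and out-degree exactly one in `C`) that has no
fixed points (cycles of length 1) and no 2-cycles, i.e. all its cycles have length ≥ 3. -/
def IsThreeCycleCover {V : Type*} (A C : Finset (V × V)) : Prop :=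
  C ⊆ A ∧ ∃ π : Equiv.Perm V, (∀ v, π v ≠ v) ∧ (∀ v, π (π v) ≠ v) ∧
    ∀ a : V × V, a ∈ C ↔ a.2 = π a.1

/-- An antisymmetric subset of a symmetric loopless arc set extends to an orientation-set. -/
theorem exists_isOrientationSet_superset {V : Type*} [Fintype V] [DecidableEq V]
    {B C : Finset (V × V)} (hloop : ∀ v : V, (v, v) ∉ B) (hCB : C ⊆ B)
    (hsymm : ∀ p ∈ B, p.swap ∈ B) (hC : ∀ p ∈ C, p.swap ∉ C) :
    ∃ σ, IsOrientationSet B σ ∧ C ⊆ σ := by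
  classical
  let e := Fintype.equivFin V
  refine ⟨B.filter fun p => p ∈ C ∨ (p.swap ∉ C ∧ e p.1 < e p.2), ⟨Finset.filter_subset _ _, ?_⟩,
    fun p hp => Finset.mem_filter.2 ⟨hCB hp, Or.inl hp⟩⟩
  rintro ⟨x, y⟩ hp
  have hs := hsymm _ hp
  have hne : e x ≠ e y := by
    intro h
    rw [e.injective h] at hp
    exact hloop _ hp
  have h1 := hC (x, y)
  have h2 := hC (y, x)
  simp only [Prod.swap_prod_mk] at hs h1 h2
  simp only [Finset.mem_filter, hp, hs, true_and, Prod.swap_prod_mk]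
  rcases lt_or_gt_of_ne hne with h | h
  · have := h.not_gt
    tauto
  · have := h.not_gt
    tauto

/-- A control matching with as many arcs as there are vertices is the graph of a permutation. -/
theorem IsControlMatching.exists_perm {V : Type*} [Fintype V] {A M : Finset (V × V)}
    (hM : IsControlMatching A M) (hcard : M.card = Fintype.card V) :
    ∃ π : Equiv.Perm V, ∀ a : V × V, a ∈ M ↔ a.2 = π a.1 := by
  classical
  obtain ⟨-, hfst, hsnd⟩ := hM
  have himage : M.image Prod.fst = Finset.univ := by
    rw [← Finset.card_eq_iff_eq_univ, Finset.card_image_of_injOn fun a ha b hb => hfst a ha b hb,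
      hcard]
  have hout : ∀ v, ∃ w, (v, w) ∈ M := by
    intro v
    have hv := Finset.mem_univ v
    rw [← himage, Finset.mem_image] at hv
    obtain ⟨⟨x, y⟩, ha, rfl⟩ := hv
    exact ⟨y, ha⟩
  choose f hf using hout
  have hinj : Function.Injective f := fun v w h =>
    congrArg Prod.fst (hsnd _ (hf v) _ (hf w) h)
  refine ⟨Equiv.ofBijective f (Finite.injective_iff_bijective.1 hinj), ?_⟩
  rintro ⟨x, y⟩
  constructor
  · intro ha
    exact congrArg Prod.snd (hfst _ ha _ (hf x) rfl)
  · rintro (rfl : y = f x)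
    exact hf x

/-- The simple digraph `(V, A)` has a 3-cycle cover iff some orientation-set of its
symmetric closure `A'` (with weight 1 on arcs of `A` and 0 on the added reverse arcs)
contains a control matching of weight `|V|`. -/
theorem stmt6 {V : Type*} [Fintype V] [DecidableEq V] (A : Finset (V × V))
    (hsimple : ∀ v : V, (v, v) ∉ A) :
    (∃ C : Finset (V × V), IsThreeCycleCover A C) ↔
      ∃ σ M : Finset (V × V), IsOrientationSet (A ∪ A.image Prod.swap) σ ∧
        IsControlMatching (A ∪ A.image Prod.swap) M ∧ M ⊆ σ ∧
        (∑ p ∈ M, if p ∈ A then (1 : ℕ) else 0) = Fintype.card V := by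
  constructor
  · rintro ⟨C, hCA, π, -, hπ, hC⟩
    have hCB : C ⊆ A ∪ A.image Prod.swap := hCA.trans Finset.subset_union_left
    obtain ⟨σ, hσ, hCσ⟩ := exists_isOrientationSet_superset
      (B := A ∪ A.image Prod.swap) (C := C) (by simpa using hsimple) hCB
      (by simp only [Finset.mem_union, Finset.mem_image]
          rintro p (hp | ⟨q, hq, rfl⟩)
          · exact Or.inr ⟨p, hp, rfl⟩
          · exact Or.inl (by simpa using hq))
      (by rintro ⟨x, y⟩ hp hq
          have hp' : y = π x := (hC _).1 hp
          have hq' : x = π y := (hC _).1 hq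
          exact hπ x (by rw [← hp', ← hq']))
    refine ⟨σ, C, hσ, ⟨hCB, ?_, ?_⟩, hCσ, ?_⟩
    · intro a ha b hb h
      exact Prod.ext h (by rw [(hC a).1 ha, (hC b).1 hb, h])
    · intro a ha b hb h
      exact Prod.ext (π.injective (by rw [← (hC a).1 ha, ← (hC b).1 hb, h])) h
    · rw [Finset.sum_congr rfl fun p hp => if_pos (hCA hp), ← Finset.card_eq_sum_ones]
      have himage : C = Finset.univ.image fun v => (v, π v) := by
        ext ⟨x, y⟩
        simp [hC, eq_comm]
      rw [himage, Finset.card_image_of_injective _ fun v w h => congrArg Prod.fst h,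
        Finset.card_univ]
  · rintro ⟨σ, M, hσ, ⟨hMB, hfst, hsnd⟩, hMσ, hw⟩
    rw [← Finset.card_filter] at hw
    have hsub : M.filter (· ∈ A) ⊆ M := Finset.filter_subset _ _
    have hmatch : IsControlMatching A (M.filter (· ∈ A)) :=
      ⟨fun p hp => (Finset.mem_filter.1 hp).2,
        fun a ha b hb => hfst a (hsub ha) b (hsub hb),
        fun a ha b hb => hsnd a (hsub ha) b (hsub hb)⟩
    obtain ⟨π, hπ⟩ := hmatch.exists_perm hw
    have harc : ∀ v, (v, π v) ∈ M.filter (· ∈ A) := fun v => (hπ _).2 rfl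
    refine ⟨M.filter (· ∈ A), hmatch.1, π, fun v hv => ?_, fun v hv => ?_, hπ⟩
    · have := hmatch.1 (harc v)
      rw [hv] at this
      exact hsimple v this
    · have h := hsub (harc (π v))
      rw [hv] at h
      exact (hσ.2 _ (hMB (hsub (harc v)))).1 (hMσ (hsub (harc v))) (hMσ h)
end
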